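/- There exist a field K, finite-dimensional K-algebras S and R, and a 6-dimensional S-R-bimodule C which is a cotilting bimodule and indecomposable as a bimodule, such that: (1) C has codimension 2 both in an injective envelope E of the left S-module C and in an injective envelope E' of the right R-module C; (2) there is an S-R-bimodule D whose underlying left S-module is E, which contains C as a sub-bimodule and which is indecomposable as a bimodule; and (3) there is an S-R-bimodule D' whose underlying right R-module is E', which contains C as a sub-bimodule and which is a direct sum of two nonzero sub-bimodules. In particular, the property of being an indecomposable bimodule is neither inherited by such extensions nor left–right symmetric. -/

import Mathlib

open CategoryTheory

noncomputable section

/-! ### Generalities -/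

section Generalities

variable (A : Type) [Ring A]

/-- `Ext^n_A(M, N) = 0`. -/
def ExtVanish (M N : ModuleCat.{0} A) (n : ℕ) : Prop :=
  Subsingleton (((Ext ℤ (ModuleCat.{0} A) n).obj (Opposite.op M)).obj N)

/-- `N ∈ Prod M`: `N` is a direct summand of a direct product of copies of `M`. -/
def InProd (M N : ModuleCat.{0} A) : Prop :=
  ∃ (ι : Type) (s : N ⟶ ModuleCat.of A (ι → M)) (r : ModuleCat.of A (ι → M) ⟶ N),
    s ≫ r = 𝟙 N

/-- `Q` is an injective cogenerator of the category of left `A`-modules. -/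
def IsInjectiveCogenerator (Q : ModuleCat.{0} A) : Prop :=
  Injective Q ∧ ∀ X : ModuleCat.{0} A, ∃ (ι : Type) (f : X ⟶ ModuleCat.of A (ι → Q)),
    Function.Injective f

/-- `C` is a classical cotilting left `A`-module: (i) `C` has injective dimension at most `1`;
(ii) `Ext¹(C^I, C) = 0` for every direct product of copies of `C`; (iii) there is a short
exact sequence `0 → C' → C'' → Q → 0` with `Q` an injective cogenerator and
`C', C'' ∈ Prod C`. -/
def IsClassicalCotilting (C : Type) [AddCommGroup C] [Module A C] : Prop :=
  (∀ (X : ModuleCat.{0} A) (i : ℕ), 1 < i → ExtVanish A X (ModuleCat.of A C) i) ∧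
  (∀ ι : Type, ExtVanish A (ModuleCat.of A (ι → C)) (ModuleCat.of A C) 1) ∧
  (∃ (Q C' C'' : ModuleCat.{0} A) (f : C' ⟶ C'') (g : C'' ⟶ Q),
    IsInjectiveCogenerator A Q ∧ InProd A (ModuleCat.of A C) C' ∧
    InProd A (ModuleCat.of A C) C'' ∧
    Function.Injective f ∧ Function.Surjective g ∧ Function.Exact f g)

/-- `E`, together with the embedding `j`, is an injective envelope of `C`:
`E` is injective, `j` is injective, and the image of `j` is essential in `E`. -/
def IsInjEnvelope (C E : Type) [AddCommGroup C] [Module A C]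
    [AddCommGroup E] [Module A E] (j : C →ₗ[A] E) : Prop :=
  Module.Injective A E ∧ Function.Injective j ∧
    ∀ N : Submodule A E, N ≠ ⊥ → N ⊓ LinearMap.range j ≠ ⊥

variable (B : Type) [Ring B]

/-- an `A`-linear endomorphism commuting with a second (commuting) `B`-action, i.e. an
endomorphism of bimodules. -/
def CommutesWith (M : Type) [AddCommGroup M] [Module A M] [Module B M]
    (p : M →ₗ[A] M) : Prop :=
  ∀ (b : B) (x : M), p (b • x) = b • p x

/-- a bimodule (with commuting `A`- and `B`-actions) is indecomposable iff it is nonzero and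
its only idempotent bimodule endomorphisms are `0` and the identity. -/
def BimodIndecomposable (M : Type) [AddCommGroup M] [Module A M] [Module B M] : Prop :=
  Nontrivial M ∧ ∀ p : M →ₗ[A] M, CommutesWith A B M p → p ∘ₗ p = p →
    p = 0 ∨ p = LinearMap.id

/-- a bimodule is a direct sum of two nonzero sub-bimodules iff it admits a nontrivial
idempotent bimodule endomorphism. -/
def BimodDecomposable (M : Type) [AddCommGroup M] [Module A M] [Module B M] : Prop :=
  ∃ p : M →ₗ[A] M, CommutesWith A B M p ∧ p ∘ₗ p = p ∧ p ≠ 0 ∧ p ≠ LinearMap.id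

end Generalities

/-- `C`, an `S`-`R`-bimodule over a field `K` (both algebras and the bimodule being
finite-dimensional over `K`), is a cotilting bimodule: it is faithfully balanced and is a
classical cotilting module on both sides. -/
def IsCotiltingBimodule (K S R C : Type) [Field K] [Ring S] [Algebra K S] [Ring R]
    [Algebra K R] [AddCommGroup C] [Module S C] [Module Rᵐᵒᵖ C] [SMulCommClass S Rᵐᵒᵖ C] :
    Prop :=
  haveI : SMulCommClass Rᵐᵒᵖ S C := SMulCommClass.symm S Rᵐᵒᵖ C
  Function.Bijective (Module.toModuleEnd Rᵐᵒᵖ C : S →+* Module.End Rᵐᵒᵖ C) ∧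
  Function.Bijective (Module.toModuleEnd S C : Rᵐᵒᵖ →+* Module.End S C) ∧
  IsClassicalCotilting S C ∧
  IsClassicalCotilting Rᵐᵒᵖ C

/-! ### Statement 12: the toy example of a finite-dimensional cotilting bimodule -/

/-- The data asserted to exist in Statement 12: a field `K`, finite-dimensional `K`-algebras
`S` and `R`, a `6`-dimensional cotilting `S`-`R`-bimodule `C`, indecomposable as a bimodule,
such that (1) `C` has codimension `2` in an injective envelope `E` of the left `S`-module `C`
and in an injective envelope `E'` of the right `R`-module `C`; (2) `E` carries a bimodule
structure `D` containing `C` as a sub-bimodule which is indecomposable as a bimodule; and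
(3) `E'` carries a bimodule structure `D'` containing `C` as a sub-bimodule which is the
direct sum of two nonzero sub-bimodules. -/
structure ToyCotiltingExample where
  K : Type
  [fK : Field K]
  S : Type
  [rS : Ring S]
  [aS : Algebra K S]
  finS : FiniteDimensional K S
  R : Type
  [rR : Ring R]
  [aR : Algebra K R]
  finR : FiniteDimensional K R
  C : Type
  [abC : AddCommGroup C]
  [mSC : Module S C]
  [mRC : Module Rᵐᵒᵖ C]
  [sccC : SMulCommClass S Rᵐᵒᵖ C]
  [mKC : Module K C]
  [towSC : IsScalarTower K S C]
  [towRC : IsScalarTower K Rᵐᵒᵖ C]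
  cotilting : IsCotiltingBimodule K S R C
  dimC : Module.finrank K C = 6
  indecC : BimodIndecomposable S Rᵐᵒᵖ C
  -- the injective envelope on the left
  E : Type
  [abE : AddCommGroup E]
  [mSE : Module S E]
  [mKE : Module K E]
  [towSE : IsScalarTower K S E]
  j : C →ₗ[S] E
  envE : IsInjEnvelope S C E j
  codimE : Module.finrank K E = Module.finrank K C + 2
  -- the bimodule `D` supported on `E`
  [mRE : Module Rᵐᵒᵖ E]
  [sccE : SMulCommClass S Rᵐᵒᵖ E]
  j_right_linear : ∀ (r : Rᵐᵒᵖ) (c : C), j (r • c) = r • j c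
  indecD : BimodIndecomposable S Rᵐᵒᵖ E
  -- the injective envelope on the right
  E' : Type
  [abE' : AddCommGroup E']
  [mRE' : Module Rᵐᵒᵖ E']
  [mKE' : Module K E']
  [towRE' : IsScalarTower K Rᵐᵒᵖ E']
  j' : C →ₗ[Rᵐᵒᵖ] E'
  envE' : IsInjEnvelope Rᵐᵒᵖ C E' j'
  codimE' : Module.finrank K E' = Module.finrank K C + 2
  -- the bimodule `D'` supported on `E'`
  [mSE' : Module S E']
  [sccE' : SMulCommClass S Rᵐᵒᵖ E']
  j'_left_linear : ∀ (s : S) (c : C), j' (s • c) = s • j' c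
  decD' : BimodDecomposable Rᵐᵒᵖ S E'

/-! ### Vanishing of `Ext` through injective coresolutions of length one -/

section ExtCriteria

variable {A : Type} [Ring A]

/-- `Ext^(n+1)(X, N)` vanishes as soon as every cocycle of the complex computing it from a
projective resolution is a coboundary. -/
lemma extVanish_succ_of_cocycles {X N : ModuleCat.{0} A} (P : ProjectiveResolution X) (n : ℕ)
    (h : ∀ f : P.complex.X (n + 1) ⟶ N, P.complex.d (n + 2) (n + 1) ≫ f = 0 →
      ∃ g : P.complex.X n ⟶ N, P.complex.d (n + 1) n ≫ g = f) :
    ExtVanish A X N (n + 1) := by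
  have hz : Limits.IsZero
      (((Ext ℤ (ModuleCat.{0} A) (n + 1)).obj (Opposite.op X)).obj N) := by
    refine Limits.IsZero.of_iso ?_ (P.isoExt (n + 1) N)
    rw [← HomologicalComplex.exactAt_iff_isZero_homology,
      HomologicalComplex.exactAt_iff' _ n (n + 1) (n + 2) (by simp) (by simp),
      ShortComplex.moduleCat_exact_iff]
    intro f hf
    exact h f hf
  exact ModuleCat.subsingleton_of_isZero hz

variable {S : ShortComplex (ModuleCat.{0} A)}

/-- A module with an injective coresolution of length one has vanishing `Ext^i`, `i > 1`. -/
lemma extVanish_of_shortExact (hS : S.ShortExact) [Injective S.X₂] [Injective S.X₃]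
    (X : ModuleCat.{0} A) (i : ℕ) (hi : 1 < i) : ExtVanish A X S.X₁ i := by
  obtain ⟨n, rfl⟩ : ∃ n, i = n + 2 := ⟨i - 2, by omega⟩
  have := hS.mono_f
  have := hS.epi_g
  obtain ⟨P⟩ := HasProjectiveResolution.out (Z := X)
  refine extVanish_succ_of_cocycles P (n + 1) fun f hf => ?_
  let a : P.complex.X (n + 1) ⟶ S.X₂ :=
    (P.exact_succ (n + 1)).descToInjective (f ≫ S.f) (by simp [reassoc_of% hf])
  have ha : P.complex.d (n + 2) (n + 1) ≫ a = f ≫ S.f :=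
    (P.exact_succ (n + 1)).comp_descToInjective _ _
  let b : P.complex.X n ⟶ S.X₃ :=
    (P.exact_succ n).descToInjective (a ≫ S.g) (by simp [reassoc_of% ha])
  have hb : P.complex.d (n + 1) n ≫ b = a ≫ S.g := (P.exact_succ n).comp_descToInjective _ _
  let c : P.complex.X n ⟶ S.X₂ := Projective.factorThru b S.g
  have hc : c ≫ S.g = b := Projective.factorThru_comp b S.g
  have hk : (a - P.complex.d (n + 1) n ≫ c) ≫ S.g = 0 := by simp [hc, hb]
  refine ⟨hS.exact.lift _ hk, ?_⟩
  rw [← cancel_mono S.f, Category.assoc, hS.exact.lift_f, Preadditive.comp_sub, ha]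
  simp

/-- If `S.X₂` is injective and every morphism `X ⟶ S.X₃` lifts to `S.X₂`, then
`Ext¹(X, S.X₁) = 0`. -/
lemma extVanish_one_of_lift (hS : S.ShortExact) [Injective S.X₂] (X : ModuleCat.{0} A)
    (hX : ∀ b : X ⟶ S.X₃, ∃ c : X ⟶ S.X₂, c ≫ S.g = b) : ExtVanish A X S.X₁ 1 := by
  have := hS.mono_f
  obtain ⟨P⟩ := HasProjectiveResolution.out (Z := X)
  refine extVanish_succ_of_cocycles P 0 fun f hf => ?_
  let a : P.complex.X 0 ⟶ S.X₂ :=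
    (P.exact_succ 0).descToInjective (f ≫ S.f) (by simp [reassoc_of% hf])
  have ha : P.complex.d 1 0 ≫ a = f ≫ S.f := (P.exact_succ 0).comp_descToInjective _ _
  have h0 : P.complex.d 1 0 ≫ a ≫ S.g = 0 := by simp [reassoc_of% ha]
  let π : P.complex.X 0 ⟶ X := P.π.f 0
  have hπ : P.complex.d 1 0 ≫ π = 0 := P.complex_d_comp_π_f_zero
  obtain ⟨b, hb⟩ : ∃ b : X ⟶ S.X₃, π ≫ b = a ≫ S.g := ⟨_, P.exact₀.g_desc _ h0⟩
  obtain ⟨c, hc⟩ := hX b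
  have hk : (a - π ≫ c) ≫ S.g = 0 := by simp [hc, hb]
  refine ⟨hS.exact.lift _ hk, ?_⟩
  rw [← cancel_mono S.f, Category.assoc, hS.exact.lift_f, Preadditive.comp_sub, ha,
    reassoc_of% hπ]
  simp

end ExtCriteria

/-! ### Incidence algebras and their thin modules -/

section Thin

/-- The combinatorial description of a thin module with basis `Fin n`: the basis vector `x`
lies over the vertex `vertex x`, in the direct summand `comp x`. -/
structure Shape (P : Type) (n : ℕ) where
  vertex : Fin n → P
  comp : Fin n → ℕ

variable {K P : Type} [Field K] {n : ℕ}

/-- The block matrix on `Fin n` obtained from a matrix on `P`. -/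
def Shape.mat (T : Shape P n) (M : Matrix P P K) : Matrix (Fin n) (Fin n) K :=
  Matrix.of fun x y => if T.comp x = T.comp y then M (T.vertex x) (T.vertex y) else 0

lemma Shape.mat_apply (T : Shape P n) (M : Matrix P P K) (x y : Fin n) :
    T.mat M x y = if T.comp x = T.comp y then M (T.vertex x) (T.vertex y) else 0 := rfl

lemma Shape.mat_add (T : Shape P n) (M N : Matrix P P K) :
    T.mat (M + N) = T.mat M + T.mat N := by
  ext x y
  simp only [Shape.mat_apply, Matrix.add_apply]
  split_ifs <;> simp

lemma Shape.mat_smul (T : Shape P n) (k : K) (M : Matrix P P K) :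
    T.mat (k • M) = k • T.mat M := by
  ext x y
  simp [Shape.mat_apply]

variable {r : P → P → Prop}

/-- Every summand is supported, with multiplicity one, on a convex set of vertices. -/
structure Shape.IsConvex (r : P → P → Prop) (T : Shape P n) : Prop where
  ext : ∀ x y, T.comp x = T.comp y → T.vertex x = T.vertex y → x = y
  convex : ∀ x y k, T.comp x = T.comp y → r (T.vertex x) k → r k (T.vertex y) →
    ∃ z, T.comp z = T.comp x ∧ T.vertex z = k

lemma Shape.IsConvex.mat_one [DecidableEq P] {T : Shape P n} (h : T.IsConvex r) :
    T.mat (1 : Matrix P P K) = 1 := by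
  ext x y
  rw [Shape.mat_apply, Matrix.one_apply, Matrix.one_apply]
  by_cases hxy : x = y
  · simp [hxy]
  · rw [if_neg hxy]
    split_ifs with h1 h2
    · exact absurd (h.ext _ _ h1 h2) hxy
    all_goals rfl

variable [Fintype P]

lemma Shape.IsConvex.mat_mul {T : Shape P n} (h : T.IsConvex r) (M N : Matrix P P K)
    (hM : ∀ i j, ¬ r i j → M i j = 0) (hN : ∀ i j, ¬ r i j → N i j = 0) :
    T.mat (M * N) = T.mat M * T.mat N := by
  ext x y
  rw [Matrix.mul_apply, Shape.mat_apply]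
  split_ifs with hxy
  · rw [Matrix.mul_apply]
    symm
    refine Finset.sum_bij_ne_zero (fun z _ _ => T.vertex z) (by simp) ?_ ?_ ?_
    · intro z _ hz z' _ hz' e
      have h1 : T.comp x = T.comp z := by
        by_contra h'; simp [Shape.mat_apply, h'] at hz
      have h2 : T.comp x = T.comp z' := by
        by_contra h'; simp [Shape.mat_apply, h'] at hz'
      exact h.ext _ _ (h1.symm.trans h2) e
    · intro k _ hk
      obtain ⟨z, hz, rfl⟩ := h.convex x y k hxy
        (by by_contra h'; simp [hM _ _ h'] at hk) (by by_contra h'; simp [hN _ _ h'] at hk)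
      exact ⟨z, Finset.mem_univ _, by simpa [Shape.mat_apply, hz, hxy] using hk, rfl⟩
    · intro z _ hz
      have h1 : T.comp x = T.comp z := by
        by_contra h'; simp [Shape.mat_apply, h'] at hz
      simp [Shape.mat_apply, ← h1, hxy]
  · symm
    refine Finset.sum_eq_zero fun z _ => ?_
    simp only [Shape.mat_apply]
    split_ifs with h1 h2
    · exact absurd (h1.trans h2) hxy
    all_goals simp

/-- An identification of the `K`-algebra `A` with the algebra of all `P × P` matrices supported
on the relation `r`. -/
structure IncidenceModel (K A : Type) [Field K] [Ring A] [Algebra K A] {P : Type} [Fintype P]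
    [DecidableEq P] (r : P → P → Prop) where
  toMat : A →ₐ[K] Matrix P P K
  injective : Function.Injective toMat
  apply_eq_zero : ∀ a i j, ¬ r i j → toMat a i j = 0
  surjective : ∀ M : Matrix P P K, (∀ i j, ¬ r i j → M i j = 0) → ∃ a, toMat a = M

variable [DecidableEq P] {A : Type} [Ring A] [Algebra K A] (H : IncidenceModel K A r)

/-- The representation of an incidence algebra attached to a shape. -/
def IncidenceModel.rep (T : Shape P n) (h : T.IsConvex r) : A →+* Matrix (Fin n) (Fin n) K where
  toFun a := T.mat (H.toMat a)
  map_one' := by rw [map_one, h.mat_one]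
  map_mul' a b := by
    rw [map_mul, h.mat_mul _ _ (H.apply_eq_zero a) (H.apply_eq_zero b)]
  map_zero' := by
    rw [map_zero, ← zero_smul K (0 : Matrix P P K), Shape.mat_smul, zero_smul]
  map_add' a b := by rw [map_add, Shape.mat_add]

/-- The thin module attached to a shape. -/
abbrev IncidenceModel.thinModule (T : Shape P n) (h : T.IsConvex r) : Module A (Fin n → K) :=
  Module.compHom (Fin n → K) ((Matrix.toLinAlgEquiv' :
    Matrix (Fin n) (Fin n) K ≃ₐ[K] _).toRingEquiv.toRingHom.comp (H.rep T h))

/-- The given action of `A` on `Fin n → K` is the thin one described by `T`. -/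
def IncidenceModel.ActsBy (T : Shape P n) [Module A (Fin n → K)] : Prop :=
  ∀ (a : A) (v : Fin n → K), a • v = (T.mat (H.toMat a)).mulVec v

lemma IncidenceModel.actsBy_thinModule (T : Shape P n) (h : T.IsConvex r) :
    letI := H.thinModule T h
    H.ActsBy T := fun _ _ => rfl

/-- The matrix unit at `(i, j)`, or `0` if it does not belong to the algebra. -/
def IncidenceModel.unit (i j : P) : A := by
  classical exact if h : r i j then (H.surjective (Matrix.single i j 1) (by
    rintro k l hkl
    rw [Matrix.single_apply, if_neg]
    rintro ⟨rfl, rfl⟩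
    exact hkl h)).choose else 0

lemma IncidenceModel.toMat_unit {i j : P} (h : r i j) :
    H.toMat (H.unit i j) = Matrix.single i j 1 := by
  rw [unit, dif_pos h]
  exact Exists.choose_spec (p := fun a => H.toMat a = Matrix.single i j 1) _

lemma IncidenceModel.unit_eq_zero {i j : P} (h : ¬ r i j) : H.unit i j = 0 := dif_neg h

lemma IncidenceModel.sum_unit (hr : ∀ i, r i i) : ∑ i, H.unit i i = 1 := by
  apply H.injective
  rw [map_sum, map_one]
  simp_rw [fun i => H.toMat_unit (hr i)]
  ext i j
  rw [Matrix.sum_apply, Finset.sum_eq_single i]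
  · simp [Matrix.single_apply, Matrix.one_apply]
  · intro k _ hk
    simp [hk]
  · simp

lemma IncidenceModel.unit_mul {i j : P} (h : r i j) (a : A) :
    H.unit i j * a = ∑ k, H.toMat a j k • H.unit i k := by
  have key : ∀ k, H.toMat (H.unit i j * a) i k = H.toMat a j k := by
    intro k
    rw [map_mul, H.toMat_unit h]
    simp
  apply H.injective
  ext l k
  rw [map_sum, Matrix.sum_apply]
  by_cases hl : l = i
  · subst hl
    rw [key, Finset.sum_eq_single k]
    · by_cases hk : r l k
      · simp [H.toMat_unit hk]
      · rw [H.unit_eq_zero hk, ← key, H.apply_eq_zero _ _ _ hk]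
        simp
    · intro k' _ hk'
      by_cases hk : r l k'
      · simp [H.toMat_unit hk, hk']
      · simp [H.unit_eq_zero hk]
    · simp
  · rw [Finset.sum_eq_zero]
    · rw [map_mul, H.toMat_unit h]
      simp [hl]
    · intro k' _
      by_cases hk : r i k'
      · simp [H.toMat_unit hk, Ne.symm hl]
      · simp [H.unit_eq_zero hk]

section Action

variable {H} {T : Shape P n} [Module A (Fin n → K)] (hT : H.ActsBy T)
include hT

lemma IncidenceModel.ActsBy.smul_apply (a : A) (v : Fin n → K) (x : Fin n) :
    (a • v) x = ∑ y, if T.comp x = T.comp y then H.toMat a (T.vertex x) (T.vertex y) * v y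
      else 0 := by
  rw [hT]
  simp [Matrix.mulVec, dotProduct, Shape.mat_apply]

lemma IncidenceModel.ActsBy.unit_smul_apply {i j : P} (h : r i j) (v : Fin n → K) (x : Fin n) :
    (H.unit i j • v) x =
      ∑ y, if T.comp x = T.comp y ∧ T.vertex x = i ∧ T.vertex y = j then v y else 0 := by
  rw [hT.smul_apply]
  refine Finset.sum_congr rfl fun y _ => ?_
  rw [H.toMat_unit h, Matrix.single_apply]
  by_cases h1 : T.comp x = T.comp y <;> by_cases h2 : i = T.vertex x <;>
    by_cases h3 : j = T.vertex y <;> simp [h1, h2, h3, eq_comm]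

lemma IncidenceModel.ActsBy.unit_smul_apply_of_comp_eq (hc : T.IsConvex r) {x y : Fin n}
    (h : r (T.vertex x) (T.vertex y)) (hxy : T.comp x = T.comp y) (v : Fin n → K) :
    (H.unit (T.vertex x) (T.vertex y) • v) x = v y := by
  rw [hT.unit_smul_apply h, Finset.sum_eq_single y]
  · simp [hxy]
  · intro z _ hz
    rw [if_neg]
    rintro ⟨h1, -, h3⟩
    exact hz (hc.ext _ _ (h1.symm.trans hxy) h3)
  · simp

lemma IncidenceModel.ActsBy.unit_smul_apply_of_ne {i j : P} (h : r i j) {x : Fin n}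
    (hx : T.vertex x ≠ i) (v : Fin n → K) : (H.unit i j • v) x = 0 := by
  rw [hT.unit_smul_apply h]
  simp [hx]

lemma IncidenceModel.ActsBy.isScalarTower : IsScalarTower K A (Fin n → K) where
  smul_assoc k a v := by
    rw [hT, hT, map_smul, Shape.mat_smul, Matrix.smul_mulVec]

end Action

/-! ### Homomorphisms of thin modules -/

/-- The matrix `M` intertwines the thin modules attached to `T` and `T'`. -/
structure Shape.Intertwines {P : Type} {n m : ℕ} (r : P → P → Prop) [DecidableEq P]
    (T : Shape P n) (T' : Shape P m) (M : Matrix (Fin m) (Fin n) K) : Prop where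
  homogeneous : ∀ y x, T'.vertex y ≠ T.vertex x → M y x = 0
  natural : ∀ y x, r (T'.vertex y) (T.vertex x) →
    (∑ z, if T'.comp y = T'.comp z ∧ T'.vertex z = T.vertex x then M z x else 0) =
      ∑ w, if T.comp w = T.comp x ∧ T.vertex w = T'.vertex y then M y w else 0

section Hom

variable {m : ℕ} {H} {T : Shape P n} {T' : Shape P m} [Module A (Fin n → K)]
  [Module A (Fin m → K)] (hT : H.ActsBy T) (hT' : H.ActsBy T')
include hT' hT

/-- The homomorphism of thin modules given by an intertwining matrix. -/
def IncidenceModel.ActsBy.hom {M : Matrix (Fin m) (Fin n) K} (hM : T.Intertwines r T' M) :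
    (Fin n → K) →ₗ[A] (Fin m → K) where
  toFun := M.mulVec
  map_add' := M.mulVec_add
  map_smul' a v := by
    rw [hT, RingHom.id_apply, hT', Matrix.mulVec_mulVec, Matrix.mulVec_mulVec]
    congr 1
    ext y x
    have h1 : ∀ z, T'.mat (H.toMat a) y z * M z x = H.toMat a (T'.vertex y) (T.vertex x) *
        if T'.comp y = T'.comp z ∧ T'.vertex z = T.vertex x then M z x else 0 := by
      intro z
      rw [Shape.mat_apply]
      by_cases hz : T'.vertex z = T.vertex x
      · simp [hz]
      · simp [hM.homogeneous z x hz]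
    have h2 : ∀ w, M y w * T.mat (H.toMat a) w x = H.toMat a (T'.vertex y) (T.vertex x) *
        if T.comp w = T.comp x ∧ T.vertex w = T'.vertex y then M y w else 0 := by
      intro w
      rw [Shape.mat_apply]
      by_cases hw : T.vertex w = T'.vertex y
      · by_cases hc : T.comp w = T.comp x <;> simp [hw, hc, mul_comm]
      · simp [hM.homogeneous y w (Ne.symm hw)]
    rw [Matrix.mul_apply, Matrix.mul_apply]
    simp_rw [h1, h2]
    rw [← Finset.mul_sum, ← Finset.mul_sum]
    by_cases hr : r (T'.vertex y) (T.vertex x)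
    · rw [hM.natural y x hr]
    · simp [H.apply_eq_zero _ _ _ hr]

omit hT' in
lemma IncidenceModel.ActsBy.map_smul_base {N : Type} [AddCommGroup N] [Module A N] [Module K N]
    [IsScalarTower K A N] (f : (Fin n → K) →ₗ[A] N) (k : K) (v : Fin n → K) :
    f (k • v) = k • f v := by
  have := hT.isScalarTower
  rw [← algebraMap_smul A k v, map_smul, algebraMap_smul]

/-- The matrix of a homomorphism of thin modules. -/
lemma IncidenceModel.ActsBy.exists_matrix (hr : ∀ i, r i i) (hc : T.IsConvex r)
    (f : (Fin n → K) →ₗ[A] (Fin m → K)) :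
    ∃ M : Matrix (Fin m) (Fin n) K, T.Intertwines r T' M ∧ ∀ v, f v = M.mulVec v := by
  have := hT'.isScalarTower
  let g : (Fin n → K) →ₗ[K] (Fin m → K) :=
    { toFun := f, map_add' := f.map_add, map_smul' := hT.map_smul_base f }
  have hg : ∀ v, f v = (LinearMap.toMatrix' g).mulVec v := fun v =>
    (LinearMap.toMatrix'_mulVec g v).symm
  have hent : ∀ y x, LinearMap.toMatrix' g y x = f (Pi.single x 1) y := fun y x => by
    rw [LinearMap.toMatrix'_apply]; simp [g]
  have hsum : ∀ (y x) (i : P), r i (T.vertex x) →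
      f (H.unit i (T.vertex x) • Pi.single x 1) y =
      ∑ w, if T.comp w = T.comp x ∧ T.vertex w = i then LinearMap.toMatrix' g y w else 0 := by
    intro y x i hi
    rw [hg, Matrix.mulVec, dotProduct]
    refine Finset.sum_congr rfl fun w _ => ?_
    rw [hT.unit_smul_apply hi, Finset.sum_eq_single x]
    · by_cases h1 : T.comp w = T.comp x <;> by_cases h2 : T.vertex w = i <;> simp [h1, h2]
    · intro z _ hz
      simp [hz]
    · simp
  refine ⟨LinearMap.toMatrix' g, ⟨fun y x hyx => ?_, fun y x hyx => ?_⟩, hg⟩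
  · have h1 := hsum y x _ (hr (T.vertex x))
    rw [map_smul, hT'.unit_smul_apply_of_ne (hr _) hyx, Finset.sum_eq_single x] at h1
    · simpa using h1.symm
    · intro w _ hw
      rw [if_neg]
      exact fun h => hw (hc.ext _ _ h.1 h.2)
    · simp
  · rw [← hsum y x _ hyx, map_smul, hT'.unit_smul_apply hyx]
    simp [hent]

end Hom

/-! ### Cofree thin modules -/

/-- Every summand of `T` is the full injective envelope of a simple module, whose socle is
spanned by the basis vector given by `s`. -/
structure Shape.IsCofree {P : Type} {n : ℕ} (r : P → P → Prop) (T : Shape P n)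
    (s : Fin n → Fin n) : Prop where
  comp_socle : ∀ x, T.comp (s x) = T.comp x
  socle_eq : ∀ x y, T.comp x = T.comp y → s x = s y
  rel_socle : ∀ x, r (T.vertex (s x)) (T.vertex x)
  full : ∀ x k, r (T.vertex (s x)) k → ∃ z, T.comp z = T.comp x ∧ T.vertex z = k

lemma Shape.IsCofree.socle_socle {P : Type} {n : ℕ} {r : P → P → Prop} {T : Shape P n}
    {s : Fin n → Fin n} (hs : T.IsCofree r s) (x : Fin n) : s (s x) = s x :=
  hs.socle_eq _ _ (hs.comp_socle x)

section Cofree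

variable {H} {T : Shape P n} [Module A (Fin n → K)] (hT : H.ActsBy T)
  (hc : T.IsConvex r) {s : Fin n → Fin n} (hs : T.IsCofree r s)

include hT hc hs

/-- Homomorphisms into a cofree thin module are given by linear functionals. -/
lemma IncidenceModel.ActsBy.exists_cofreeHom {N : Type} [AddCommGroup N] [Module A N] [Module K N]
    [IsScalarTower K A N] (ψ : Fin n → N →ₗ[K] K) :
    ∃ h : N →ₗ[A] (Fin n → K), ∀ v x,
      h v x = ψ (s x) (H.unit (T.vertex (s x)) (T.vertex x) • v) := by
  refine ⟨{ toFun := fun v x => ψ (s x) (H.unit (T.vertex (s x)) (T.vertex x) • v),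
            map_add' := ?_, map_smul' := ?_ }, fun _ _ => rfl⟩
  · intro v w
    ext x
    simp
  · intro a v
    ext x
    rw [RingHom.id_apply, hT.smul_apply, ← mul_smul, H.unit_mul (hs.rel_socle x), Finset.sum_smul,
      map_sum]
    simp_rw [smul_assoc, map_smul, smul_eq_mul]
    symm
    refine Finset.sum_bij_ne_zero (fun y _ _ => T.vertex y) (by simp) ?_ ?_ ?_
    · intro y _ hy z _ hz e
      have h1 : T.comp x = T.comp y := by by_contra h'; simp [h'] at hy
      have h2 : T.comp x = T.comp z := by by_contra h'; simp [h'] at hz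
      exact hc.ext _ _ (h1.symm.trans h2) e
    · intro k _ hk
      obtain ⟨z, hz, rfl⟩ := hs.full x k (by
        by_contra h'; simp [H.unit_eq_zero h'] at hk)
      refine ⟨z, Finset.mem_univ _, ?_, rfl⟩
      simpa [hz, hs.socle_eq _ _ hz] using hk
    · intro y _ hy
      have h1 : T.comp x = T.comp y := by by_contra h'; simp [h'] at hy
      simp [h1, hs.socle_eq _ _ h1]

lemma IncidenceModel.ActsBy.injective_of_isCofree : Module.Injective A (Fin n → K) where
  out := fun X Y _ _ _ _ f hf g => by
    let : Module K X := Module.compHom X (algebraMap K A)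
    let : Module K Y := Module.compHom Y (algebraMap K A)
    have : IsScalarTower K A X := ⟨fun k a x => by
      rw [Algebra.smul_def, mul_smul]; rfl⟩
    have : IsScalarTower K A Y := ⟨fun k a x => by
      rw [Algebra.smul_def, mul_smul]; rfl⟩
    have := hT.isScalarTower
    let f' : X →ₗ[K] Y := f.restrictScalars K
    obtain ⟨ρ, hρ⟩ := LinearMap.exists_leftInverse_of_injective f'
      (LinearMap.ker_eq_bot.mpr hf)
    obtain ⟨h, hh⟩ := hT.exists_cofreeHom hc hs (N := Y)
      fun x => (LinearMap.proj x ∘ₗ g.restrictScalars K) ∘ₗ ρ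
    refine ⟨h, fun v => ?_⟩
    ext x
    rw [hh, ← f.map_smul]
    have h1 : ∀ v, ρ (f v) = v := fun v => LinearMap.congr_fun hρ v
    simp only [LinearMap.comp_apply, h1, LinearMap.proj_apply, LinearMap.restrictScalars_apply,
      g.map_smul]
    exact hT.unit_smul_apply_of_comp_eq hc (hs.rel_socle x) (hs.comp_socle x) _

/-- A cofree module in which every simple module embeds is a cogenerator. -/
lemma IncidenceModel.ActsBy.isInjectiveCogenerator (hr : ∀ i, r i i)
    (hk : ∀ k, ∃ x, T.vertex (s x) = k) :
    IsInjectiveCogenerator A (ModuleCat.of A (Fin n → K)) := by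
  constructor
  · have := hT.injective_of_isCofree hc hs
    exact Module.injective_object_of_injective_module A _
  intro X
  refine ⟨X →ₗ[A] (Fin n → K), ModuleCat.ofHom (LinearMap.pi fun h => h), ?_⟩
  rw [← LinearMap.coe_coe, injective_iff_map_eq_zero]
  intro v hv
  have hv' : ∀ h : X →ₗ[A] (Fin n → K), h v = 0 := fun h => congr_fun hv h
  let : Module K X := Module.compHom X (algebraMap K A)
  have : IsScalarTower K A X := ⟨fun k a x => by
    rw [Algebra.smul_def, mul_smul]; rfl⟩
  rw [← one_smul A v, ← H.sum_unit hr, Finset.sum_smul]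
  refine Finset.sum_eq_zero fun k _ => ?_
  obtain ⟨x, rfl⟩ := hk k
  rw [← Module.forall_dual_apply_eq_zero_iff K]
  intro χ
  obtain ⟨h, hh⟩ := hT.exists_cofreeHom hc hs fun _ => χ
  have := hh v (s x)
  rw [hs.socle_socle, hv'] at this
  exact this.symm

/-- A submodule of a cofree module is nonzero as soon as it meets the socle. -/
lemma IncidenceModel.ActsBy.essential_range {C : Type} [AddCommGroup C] [Module A C]
    (j : C →ₗ[A] (Fin n → K))
    (hj : ∀ v : Fin n → K, (∀ x, (∀ y, T.vertex x ≠ T.vertex (s y)) → v x = 0) →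
      v ∈ LinearMap.range j)
    (N : Submodule A (Fin n → K)) (hN : N ≠ ⊥) : N ⊓ LinearMap.range j ≠ ⊥ := by
  obtain ⟨v, hv, hv0⟩ := N.ne_bot_iff.mp hN
  obtain ⟨y, hy⟩ := Function.ne_iff.mp hv0
  refine (Submodule.ne_bot_iff _).mpr
    ⟨H.unit (T.vertex (s y)) (T.vertex y) • v, ⟨N.smul_mem _ hv, hj _ fun x hx => ?_⟩, ?_⟩
  · exact hT.unit_smul_apply_of_ne (hs.rel_socle y) (hx y) v
  · intro h0
    have := hT.unit_smul_apply_of_comp_eq hc (hs.rel_socle y) (hs.comp_socle y) v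
    rw [h0] at this
    exact hy this.symm

end Cofree

/-! ### A combinatorial criterion for being a cotilting module -/

/-- A split exact sequence `0 → Kⁿ → Kᵐ → Kˡ → 0` of vector spaces. -/
def MatrixSplitExact {K : Type} [Field K] {n m l : ℕ} (U : Matrix (Fin m) (Fin n) K)
    (V : Matrix (Fin l) (Fin m) K) : Prop :=
  ∃ (U' : Matrix (Fin n) (Fin m) K) (V' : Matrix (Fin m) (Fin l) K),
    V * U = 0 ∧ U' * U = 1 ∧ V * V' = 1 ∧ U * U' + V' * V = 1

lemma MatrixSplitExact.exact {K : Type} [Field K] {n m l : ℕ} {U : Matrix (Fin m) (Fin n) K}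
    {V : Matrix (Fin l) (Fin m) K} (h : MatrixSplitExact U V) :
    Function.Injective U.mulVec ∧ Function.Surjective V.mulVec ∧
      Function.Exact U.mulVec V.mulVec := by
  obtain ⟨U', V', h0, h1, h2, h3⟩ := h
  refine ⟨fun v w hvw => ?_, fun v => ⟨V'.mulVec v, ?_⟩, fun v => ⟨fun hv => ⟨U'.mulVec v, ?_⟩, ?_⟩⟩
  · rw [← Matrix.one_mulVec v, ← Matrix.one_mulVec w, ← h1, ← Matrix.mulVec_mulVec, hvw,
      Matrix.mulVec_mulVec]
  · rw [Matrix.mulVec_mulVec, h2, Matrix.one_mulVec]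
  · conv_rhs => rw [← Matrix.one_mulVec v, ← h3, Matrix.add_mulVec, ← Matrix.mulVec_mulVec,
      ← Matrix.mulVec_mulVec, hv, Matrix.mulVec_zero, add_zero]
  · rintro ⟨w, rfl⟩
    rw [Matrix.mulVec_mulVec, h0, Matrix.zero_mulVec]

/-- The thin module of shape `N` is a direct summand of a power of the one of shape `T`. -/
def Shape.InPower (K : Type) [Field K] {P : Type} [DecidableEq P] {n m : ℕ} (r : P → P → Prop)
    (T : Shape P n) (N : Shape P m) : Prop :=
  ∃ (k : ℕ) (S : Fin k → Matrix (Fin n) (Fin m) K) (R : Fin k → Matrix (Fin m) (Fin n) K),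
    (∀ t, N.Intertwines r T (S t)) ∧ (∀ t, T.Intertwines r N (R t)) ∧ ∑ t, R t * S t = 1

lemma IncidenceModel.ActsBy.inProd {H : IncidenceModel K A r} {m : ℕ} {T : Shape P n}
    {N : Shape P m}
    [Module A (Fin n → K)] [Module A (Fin m → K)] (hT : H.ActsBy T) (hN : H.ActsBy N)
    (h : T.InPower K r N) :
    InProd A (ModuleCat.of A (Fin n → K)) (ModuleCat.of A (Fin m → K)) := by
  obtain ⟨k, S, R, hS, hR, h1⟩ := h
  refine ⟨Fin k, ModuleCat.ofHom (LinearMap.pi fun t => hN.hom hT (hS t)),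
    ModuleCat.ofHom (∑ t, hT.hom hN (hR t) ∘ₗ LinearMap.proj t), ?_⟩
  ext v : 2
  change (∑ t, hT.hom hN (hR t) ∘ₗ LinearMap.proj t) (fun t => hN.hom hT (hS t) v) = v
  rw [LinearMap.sum_apply]
  change ∑ t, (R t).mulVec ((S t).mulVec v) = v
  simp_rw [Matrix.mulVec_mulVec]
  rw [← Matrix.sum_mulVec, h1, Matrix.one_mulVec]

section Lift

variable {H} {e f : ℕ} {E : Shape P e} {F : Shape P f} [Module A (Fin e → K)]
  [Module A (Fin f → K)] (hE : H.ActsBy E) (hF : H.ActsBy F)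

include hE hF in
/-- Lifting homomorphisms into a sum of simple modules along an epimorphism from an injective. -/
lemma IncidenceModel.ActsBy.exists_lift (hr : ∀ i, r i i) (hEc : E.IsConvex r) {s : Fin e → Fin e}
    (hEs : E.IsCofree r s) {G : Matrix (Fin f) (Fin e) K} (hG : E.Intertwines r F G)
    {top : P} (hFc : F.IsConvex r) (htop : ∀ x, F.vertex x = top) {σ : Fin f → Fin e}
    (hsec : ∀ y x, (∑ z, if s (σ x) = s z then G y z else 0) = if y = x then 1 else 0)
    {N : Type} [AddCommGroup N] [Module A N]
    (hN : ∀ x (v : N), H.unit (E.vertex (s (σ x))) top • v = 0 → H.unit top top • v = 0)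
    (h : N →ₗ[A] (Fin f → K)) : ∃ h' : N →ₗ[A] (Fin e → K), hE.hom hF hG ∘ₗ h' = h := by
  let _ : Module K N := Module.compHom N (algebraMap K A)
  have : IsScalarTower K A N := ⟨fun k a x => by
    rw [Algebra.smul_def, mul_smul]; rfl⟩
  have := hF.isScalarTower
  have hfix : ∀ v x, h (H.unit top top • v) x = h v x := fun v x => by
    rw [map_smul, ← htop x]
    exact hF.unit_smul_apply_of_comp_eq hFc (hr _) rfl _
  have hχ : ∀ x, ∃ χ : N →ₗ[K] K, ∀ v, χ (H.unit (E.vertex (s (σ x))) top • v) = h v x := by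
    intro x
    have hsc : ∀ (a : A) (k : K) (v : N), a • k • v = k • a • v := fun a k v => by
      rw [← algebraMap_smul A k v, ← mul_smul, ← Algebra.commutes, mul_smul, algebraMap_smul]
    let u : N →ₗ[K] N :=
      { toFun := fun v => H.unit (E.vertex (s (σ x))) top • v
        map_add' := smul_add _
        map_smul' := fun k v => hsc _ _ _ }
    let l : N →ₗ[K] K := LinearMap.proj x ∘ₗ h.restrictScalars K
    have hle : LinearMap.ker u ≤ LinearMap.ker l := fun v hv => by
      change h v x = 0
      rw [← hfix, hN x v hv, map_zero]
      rfl
    obtain ⟨χ, hχ⟩ := LinearMap.exists_extend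
      ((LinearMap.ker u).liftQ l hle ∘ₗ u.quotKerEquivRange.symm.toLinearMap)
    refine ⟨χ, fun v => ?_⟩
    have h2 := LinearMap.congr_fun hχ ⟨u v, LinearMap.mem_range_self u v⟩
    have h3 : u.quotKerEquivRange.symm ⟨u v, LinearMap.mem_range_self u v⟩ =
        (LinearMap.ker u).mkQ v := by
      rw [LinearEquiv.symm_apply_eq]; rfl
    rw [LinearMap.comp_apply, LinearMap.comp_apply, LinearEquiv.coe_coe, h3] at h2
    exact h2
  choose χ hχ using hχ
  obtain ⟨h', hh'⟩ := hE.exists_cofreeHom hEc hEs (N := N)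
    fun l => ∑ x, if s (σ x) = l then χ x else 0
  refine ⟨h', LinearMap.ext fun v => funext fun y => ?_⟩
  change ∑ z, G y z * h' v z = h v y
  have hterm : ∀ z, G y z * h' v z = ∑ x, (if s (σ x) = s z then G y z else 0) * h v x := by
    intro z
    by_cases hz : E.vertex z = top
    · rw [hh', LinearMap.sum_apply, Finset.mul_sum]
      refine Finset.sum_congr rfl fun x _ => ?_
      by_cases hx : s (σ x) = s z
      · rw [if_pos hx, if_pos hx, hz, ← hx, hχ]
      · simp [hx]
    · have : G y z = 0 := hG.homogeneous y z (by rw [htop]; exact Ne.symm hz)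
      simp [this]
  simp_rw [hterm]
  rw [Finset.sum_comm]
  simp_rw [← Finset.sum_mul, hsec]
  simp

end Lift

/-- Combinatorial data certifying that the thin module of shape `T` is a cotilting module. -/
structure Shape.CotiltingCertificate (K : Type) [Field K] {P : Type} [DecidableEq P] {n : ℕ}
    (r : P → P → Prop) (T : Shape P n) where
  {e f q a b : ℕ}
  E : Shape P e
  F : Shape P f
  Q : Shape P q
  C' : Shape P a
  C'' : Shape P b
  convex_E : E.IsConvex r
  convex_F : F.IsConvex r
  convex_Q : Q.IsConvex r
  convex_C' : C'.IsConvex r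
  convex_C'' : C''.IsConvex r
  sE : Fin e → Fin e
  sF : Fin f → Fin f
  sQ : Fin q → Fin q
  cofree_E : E.IsCofree r sE
  cofree_F : F.IsCofree r sF
  cofree_Q : Q.IsCofree r sQ
  J : Matrix (Fin e) (Fin n) K
  G : Matrix (Fin f) (Fin e) K
  intertwines_J : T.Intertwines r E J
  intertwines_G : E.Intertwines r F G
  exact_JG : MatrixSplitExact J G
  top : P
  vertex_F : ∀ x, F.vertex x = top
  σ : Fin f → Fin e
  vertex_σ : ∀ x, E.vertex (σ x) = top
  section_G : ∀ y x, (∑ z, if sE (σ x) = sE z then G y z else 0) = if y = x then 1 else 0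
  reach : ∀ x w, T.vertex w = top →
    ∃ z, T.comp z = T.comp w ∧ T.vertex z = E.vertex (sE (σ x))
  cogenerator_Q : ∀ k, ∃ x, Q.vertex (sQ x) = k
  U : Matrix (Fin b) (Fin a) K
  V : Matrix (Fin q) (Fin b) K
  intertwines_U : C'.Intertwines r C'' U
  intertwines_V : C''.Intertwines r Q V
  exact_UV : MatrixSplitExact U V
  inPower_C' : T.InPower K r C'
  inPower_C'' : T.InPower K r C''

theorem IncidenceModel.ActsBy.isClassicalCotilting {H : IncidenceModel K A r} {T : Shape P n}
    [Module A (Fin n → K)] (hT : H.ActsBy T) (hr : ∀ i, r i i) (hTc : T.IsConvex r)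
    (D : T.CotiltingCertificate K r) : IsClassicalCotilting A (Fin n → K) := by
  obtain @⟨e, f, q, a, b, E, F, Q, C', C'', cE, cF, cQ, cC', cC'', sE, sF, sQ, fE, fF, fQ, J, G,
    iJ, iG, eJG, top, vF, σ, vσ, secG, reach, cogQ, U, V, iU, iV, eUV, pC', pC''⟩ := D
  have key : ∃ S : ShortComplex (ModuleCat.{0} A), S.X₁ = ModuleCat.of A (Fin n → K) ∧
      S.ShortExact ∧ Injective S.X₂ ∧ Injective S.X₃ ∧
      ∀ (ι : Type) (h : ModuleCat.of A (ι → Fin n → K) ⟶ S.X₃),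
        ∃ h' : ModuleCat.of A (ι → Fin n → K) ⟶ S.X₂, h' ≫ S.g = h := by
    let _ := H.thinModule E cE
    let _ := H.thinModule F cF
    have hE : H.ActsBy E := H.actsBy_thinModule E cE
    have hF : H.ActsBy F := H.actsBy_thinModule F cF
    obtain ⟨hJ, hG, hJG⟩ := eJG.exact
    have hEi := hE.injective_of_isCofree cE fE
    have hFi := hF.injective_of_isCofree cF fF
    refine ⟨ModuleCat.shortComplexOfCompEqZero (hT.hom hE iJ) (hE.hom hF iG) ?_, rfl, ?_,
      Module.injective_object_of_injective_module A _,
      Module.injective_object_of_injective_module A _, fun ι h => ?_⟩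
    · exact LinearMap.ext hJG.apply_apply_eq_zero
    · exact ModuleCat.shortComplex_shortExact _ hJG hJ hG
    · have hN : ∀ x (v : ι → Fin n → K), H.unit (E.vertex (sE (σ x))) top • v = 0 →
          H.unit top top • v = 0 := by
        intro x v hv
        ext i w
        have hw := congr_fun hv i
        change (H.unit top top • v i) w = 0
        change H.unit _ top • v i = 0 at hw
        by_cases hwt : T.vertex w = top
        · obtain ⟨z, hzc, hzv⟩ := reach x w hwt
          have h1 := hT.unit_smul_apply_of_comp_eq hTc (x := w) (y := w) (hr _) rfl (v i)
          have hrel : r (T.vertex z) (T.vertex w) := by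
            rw [hzv, hwt, ← vσ x]
            exact fE.rel_socle _
          have h2 := hT.unit_smul_apply_of_comp_eq hTc hrel hzc (v i)
          rw [hwt] at h1 h2
          rw [h1, ← h2, hzv, hw]
          rfl
        · exact hT.unit_smul_apply_of_ne (hr _) hwt _
      obtain ⟨h', hh'⟩ := hE.exists_lift hF hr cE fE iG cF vF secG hN h.hom
      exact ⟨ModuleCat.ofHom h', ModuleCat.hom_ext hh'⟩
  obtain ⟨S, h₁, hS, _, _, hlift⟩ := key
  refine ⟨fun X i hi => h₁ ▸ extVanish_of_shortExact hS X i hi,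
    fun ι => h₁ ▸ extVanish_one_of_lift hS _ (hlift ι), ?_⟩
  let _ := H.thinModule Q cQ
  let _ := H.thinModule C' cC'
  let _ := H.thinModule C'' cC''
  have hQ : H.ActsBy Q := H.actsBy_thinModule Q cQ
  have hC' : H.ActsBy C' := H.actsBy_thinModule C' cC'
  have hC'' : H.ActsBy C'' := H.actsBy_thinModule C'' cC''
  exact ⟨ModuleCat.of A (Fin q → K), ModuleCat.of A (Fin a → K), ModuleCat.of A (Fin b → K),
    ModuleCat.ofHom (hC'.hom hC'' iU), ModuleCat.ofHom (hC''.hom hQ iV),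
    hQ.isInjectiveCogenerator cQ fQ hr cogQ, hT.inProd hC' pC', hT.inProd hC'' pC'', eUV.exact⟩

/-- A cofree module is the injective envelope of a submodule containing its isotypic part over
the vertices of the socle. -/
lemma IncidenceModel.ActsBy.isInjEnvelope_hom {H : IncidenceModel K A r} {m : ℕ} {T : Shape P n}
    {E : Shape P m} [Module A (Fin n → K)] [Module A (Fin m → K)] (hT : H.ActsBy T)
    (hE : H.ActsBy E) (hc : E.IsConvex r) {s : Fin m → Fin m} (hs : E.IsCofree r s)
    {J : Matrix (Fin m) (Fin n) K} (hJ : T.Intertwines r E J) {J' : Matrix (Fin n) (Fin m) K}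
    (hJ' : J' * J = 1)
    (hsocle : ∀ y w, E.vertex y = E.vertex (s w) →
      (J * J').mulVec (Pi.single y 1) = Pi.single y 1) :
    IsInjEnvelope A (Fin n → K) (Fin m → K) (hT.hom hE hJ) := by
  refine ⟨hE.injective_of_isCofree hc hs, fun v w hvw => ?_,
    hE.essential_range hc hs _ fun v hv => ⟨J'.mulVec v, ?_⟩⟩
  · change J.mulVec v = J.mulVec w at hvw
    rw [← Matrix.one_mulVec v, ← Matrix.one_mulVec w, ← hJ', ← Matrix.mulVec_mulVec, hvw,
      Matrix.mulVec_mulVec]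
  · change J.mulVec (J'.mulVec v) = v
    rw [Matrix.mulVec_mulVec]
    conv_rhs => rw [← Matrix.one_mulVec v]
    ext x
    rw [Matrix.mulVec, Matrix.mulVec, dotProduct, dotProduct]
    refine Finset.sum_congr rfl fun y _ => ?_
    by_cases hy : ∃ w, E.vertex y = E.vertex (s w)
    · obtain ⟨w, hw⟩ := hy
      have := congr_fun (hsocle y w hw) x
      rw [Matrix.mulVec_single_one, Matrix.col_apply] at this
      rw [this, Matrix.one_apply, Pi.single_apply]
    · rw [hv y fun w hw => hy ⟨w, hw⟩, mul_zero, mul_zero]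

/-! ### Thin bimodules -/

section Bimodule

variable {P' : Type} [Fintype P'] [DecidableEq P'] {r' : P' → P' → Prop} {B : Type} [Ring B]
  [Algebra K B] {H : IncidenceModel K A r} {H' : IncidenceModel K B r'} {T : Shape P n}
  {T' : Shape P' n} [Module A (Fin n → K)] [Module B (Fin n → K)]

/-- A combinatorial condition for the thin actions given by `T` and `T'` to commute. -/
structure Shape.Commutes {P P' : Type} {n : ℕ} (r : P → P → Prop) (r' : P' → P' → Prop)
    (T : Shape P n) (T' : Shape P' n) : Prop where
  vertex_eq : ∀ x y, T'.comp x = T'.comp y → T.vertex x = T.vertex y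
  vertex_eq' : ∀ x y, T.comp x = T.comp y → T'.vertex x = T'.vertex y
  card_eq : ∀ x z, r (T.vertex x) (T.vertex z) → r' (T'.vertex x) (T'.vertex z) →
    (Finset.univ.filter fun y => T.comp x = T.comp y ∧ T'.comp y = T'.comp z).card =
      (Finset.univ.filter fun y => T'.comp x = T'.comp y ∧ T.comp y = T.comp z).card

lemma IncidenceModel.ActsBy.smulCommClass (hT : H.ActsBy T) (hT' : H'.ActsBy T')
    (h : T.Commutes r r' T') : SMulCommClass A B (Fin n → K) where
  smul_comm a b v := by
    rw [hT, hT', hT', hT, Matrix.mulVec_mulVec, Matrix.mulVec_mulVec]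
    congr 1
    ext x z
    have h1 : ∀ y, T.mat (H.toMat a) x y * T'.mat (H'.toMat b) y z =
        if T.comp x = T.comp y ∧ T'.comp y = T'.comp z then
          H.toMat a (T.vertex x) (T.vertex z) * H'.toMat b (T'.vertex x) (T'.vertex z)
        else 0 := by
      intro y
      rw [Shape.mat_apply, Shape.mat_apply]
      by_cases hxy : T.comp x = T.comp y <;> by_cases hyz : T'.comp y = T'.comp z <;>
        simp [hxy, hyz]
      rw [h.vertex_eq _ _ hyz, h.vertex_eq' _ _ hxy]
    have h2 : ∀ y, T'.mat (H'.toMat b) x y * T.mat (H.toMat a) y z =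
        if T'.comp x = T'.comp y ∧ T.comp y = T.comp z then
          H.toMat a (T.vertex x) (T.vertex z) * H'.toMat b (T'.vertex x) (T'.vertex z)
        else 0 := by
      intro y
      rw [Shape.mat_apply, Shape.mat_apply]
      by_cases hxy : T'.comp x = T'.comp y <;> by_cases hyz : T.comp y = T.comp z <;>
        simp [hxy, hyz]
      rw [h.vertex_eq _ _ hxy, h.vertex_eq' _ _ hyz, mul_comm]
    rw [Matrix.mul_apply, Matrix.mul_apply]
    simp_rw [h1, h2]
    rw [← Finset.sum_filter, ← Finset.sum_filter, Finset.sum_const, Finset.sum_const]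
    by_cases hr : r (T.vertex x) (T.vertex z)
    · by_cases hr' : r' (T'.vertex x) (T'.vertex z)
      · rw [h.card_eq x z hr hr']
      · simp [H'.apply_eq_zero _ _ _ hr']
    · simp [H.apply_eq_zero _ _ _ hr]

lemma IncidenceModel.ActsBy.bijective_toModuleEnd [SMulCommClass A B (Fin n → K)]
    (hT : H.ActsBy T) (hT' : H'.ActsBy T') (hr' : ∀ i, r' i i) (hc' : T'.IsConvex r')
    (hfaithful : ∀ i j, r i j → ∃ x y, T.comp x = T.comp y ∧ T.vertex x = i ∧ T.vertex y = j)
    (hbalanced : ∀ M : Matrix (Fin n) (Fin n) K, T'.Intertwines r' T' M →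
      ∃ N : Matrix P P K, (∀ i j, ¬ r i j → N i j = 0) ∧ T.mat N = M) :
    Function.Bijective (Module.toModuleEnd B (Fin n → K) : A →+* Module.End B (Fin n → K)) := by
  constructor
  · rw [injective_iff_map_eq_zero]
    intro a ha
    have ha' : ∀ v : Fin n → K, (T.mat (H.toMat a)).mulVec v = 0 := fun v => by
      rw [← hT]; exact LinearMap.congr_fun ha v
    have h0 : T.mat (H.toMat a) = 0 := by
      ext x y
      simpa using congr_fun (ha' (Pi.single y 1)) x
    apply H.injective
    rw [map_zero]
    ext i j
    by_cases hij : r i j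
    · obtain ⟨x, y, hxy, rfl, rfl⟩ := hfaithful i j hij
      simpa [Shape.mat_apply, hxy] using congr_fun (congr_fun h0 x) y
    · exact H.apply_eq_zero _ _ _ hij
  · intro f
    obtain ⟨M, hM, hf⟩ := hT'.exists_matrix hT' hr' hc' f
    obtain ⟨N, hN, rfl⟩ := hbalanced M hM
    obtain ⟨a, rfl⟩ := H.surjective N hN
    refine ⟨a, LinearMap.ext fun v => ?_⟩
    rw [hf]
    exact hT a v

/-- Two basis vectors of a thin module which are connected by the action of the algebra. -/
def Shape.Adj {P : Type} {n : ℕ} (r : P → P → Prop) (T : Shape P n) (x y : Fin n) : Prop :=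
  T.comp x = T.comp y ∧ (r (T.vertex x) (T.vertex y) ∨ r (T.vertex y) (T.vertex x))

omit [Fintype P] in
lemma Shape.Intertwines.diag_eq {M : Matrix (Fin n) (Fin n) K} (hM : T.Intertwines r T M)
    (hc : T.IsConvex r) {x y : Fin n} (h : T.Adj r x y) : M x x = M y y := by
  have key : ∀ x y, T.comp x = T.comp y → r (T.vertex x) (T.vertex y) → M x x = M y y := by
    intro x y hxy hr
    have := hM.natural x y hr
    rw [Finset.sum_eq_single y, Finset.sum_eq_single x, if_pos ⟨hxy, rfl⟩,
      if_pos ⟨hxy, rfl⟩] at this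
    · exact this.symm
    · exact fun w _ hw => if_neg fun h => hw (hc.ext _ _ (h.1.trans hxy.symm) h.2)
    · simp
    · exact fun z _ hz => if_neg fun h => hz (hc.ext _ _ (h.1.symm.trans hxy) h.2)
    · simp
  rcases h.2 with hr | hr
  · exact key x y h.1 hr
  · exact (key y x h.1.symm hr).symm

/-- A thin bimodule with at most one basis vector over each pair of vertices is indecomposable
if its basis is connected, as witnessed by a rooted tree. -/
lemma IncidenceModel.ActsBy.bimodIndecomposable (hT : H.ActsBy T) (hT' : H'.ActsBy T')
    (hr : ∀ i, r i i) (hr' : ∀ i, r' i i) (hc : T.IsConvex r) (hc' : T'.IsConvex r')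
    (hinj : ∀ x y, T.vertex x = T.vertex y → T'.vertex x = T'.vertex y → x = y)
    {parent : Fin n → Fin n} (hparent : ∀ x, T.Adj r x (parent x) ∨ T'.Adj r' x (parent x))
    {root : Fin n} {k : ℕ} (hroot : ∀ x, parent^[k] x = root) :
    BimodIndecomposable A B (Fin n → K) := by
  have : Nonempty (Fin n) := ⟨root⟩
  refine ⟨inferInstance, fun p hp hpp => ?_⟩
  obtain ⟨M, hM, hpM⟩ := hT.exists_matrix hT hr hc p
  obtain ⟨M', hM', hpM'⟩ := hT'.exists_matrix hT' hr' hc'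
    { toFun := p, map_add' := p.map_add, map_smul' := hp }
  have hMM : M' = M := by
    refine Matrix.ext_of_mulVec_single fun x => ?_
    rw [← hpM, ← hpM']
    rfl
  subst hMM
  have hstep : ∀ x, M' x x = M' (parent x) (parent x) := fun x =>
    (hparent x).elim (hM.diag_eq hc) (hM'.diag_eq hc')
  have hiter : ∀ (k : ℕ) x, M' x x = M' (parent^[k] x) (parent^[k] x) := by
    intro k
    induction k with
    | zero => exact fun _ => rfl
    | succ k ih => exact fun x => (hstep x).trans (ih _)
  have hscalar : ∀ v, p v = M' root root • v := by
    intro v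
    rw [hpM]
    ext x
    rw [Matrix.mulVec, dotProduct, Finset.sum_eq_single x, hiter k x, hroot]
    · rfl
    · intro y _ hyx
      by_cases h1 : T.vertex x = T.vertex y
      · rw [hM'.homogeneous x y fun h2 => hyx (hinj _ _ h1 h2).symm, zero_mul]
      · rw [hM.homogeneous x y h1, zero_mul]
    · simp
  have hidem : M' root root * M' root root = M' root root := by
    have := congr_fun (LinearMap.congr_fun hpp (Pi.single root 1)) root
    simpa [hscalar] using this
  rcases IsIdempotentElem.iff_eq_zero_or_one.mp hidem with h | h
  · exact Or.inl (LinearMap.ext fun v => by rw [hscalar, h, zero_smul]; rfl)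
  · exact Or.inr (LinearMap.ext fun v => by rw [hscalar, h, one_smul]; rfl)

lemma IncidenceModel.ActsBy.bimodDecomposable (hT : H.ActsBy T) (hT' : H'.ActsBy T')
    {M : Matrix (Fin n) (Fin n) K} (hM : T.Intertwines r T M) (hM' : T'.Intertwines r' T' M)
    (hidem : M * M = M) (h0 : M ≠ 0) (h1 : M ≠ 1) : BimodDecomposable A B (Fin n → K) := by
  refine ⟨hT.hom hT hM, (hT'.hom hT' hM').map_smul, LinearMap.ext fun v => ?_, fun h => h0 ?_,
    fun h => h1 ?_⟩
  · change M.mulVec (M.mulVec v) = M.mulVec v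
    rw [Matrix.mulVec_mulVec, hidem]
  · refine Matrix.ext_of_mulVec_single fun x => ?_
    rw [Matrix.zero_mulVec]
    exact LinearMap.congr_fun h _
  · refine Matrix.ext_of_mulVec_single fun x => ?_
    rw [Matrix.one_mulVec]
    exact LinearMap.congr_fun h _

end Bimodule

end Thin

/-! ### The algebras and bimodules of the example -/

section Decidable

variable {P : Type} [Fintype P] [DecidableEq P] {n : ℕ} (r : P → P → Prop) [DecidableRel r]
  (T : Shape P n)

instance : Decidable (T.IsConvex r) :=
  decidable_of_iff
    ((∀ x y, T.comp x = T.comp y → T.vertex x = T.vertex y → x = y) ∧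
      ∀ x y k, T.comp x = T.comp y → r (T.vertex x) k → r k (T.vertex y) →
        ∃ z, T.comp z = T.comp x ∧ T.vertex z = k)
    ⟨fun ⟨h₁, h₂⟩ => ⟨h₁, h₂⟩, fun ⟨h₁, h₂⟩ => ⟨h₁, h₂⟩⟩

instance (s : Fin n → Fin n) : Decidable (T.IsCofree r s) :=
  decidable_of_iff
    ((∀ x, T.comp (s x) = T.comp x) ∧ (∀ x y, T.comp x = T.comp y → s x = s y) ∧
      (∀ x, r (T.vertex (s x)) (T.vertex x)) ∧
        ∀ x k, r (T.vertex (s x)) k → ∃ z, T.comp z = T.comp x ∧ T.vertex z = k)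
    ⟨fun ⟨h₁, h₂, h₃, h₄⟩ => ⟨h₁, h₂, h₃, h₄⟩, fun ⟨h₁, h₂, h₃, h₄⟩ => ⟨h₁, h₂, h₃, h₄⟩⟩

instance {K : Type} [Field K] [DecidableEq K] {m : ℕ} (T' : Shape P m)
    (M : Matrix (Fin m) (Fin n) K) : Decidable (T.Intertwines r T' M) :=
  have (y : Fin m) : Decidable (∀ x, T'.vertex y ≠ T.vertex x → M y x = 0) := inferInstance
  decidable_of_iff
    ((∀ y x, T'.vertex y ≠ T.vertex x → M y x = 0) ∧ ∀ y x, r (T'.vertex y) (T.vertex x) →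
      (∑ z, if T'.comp y = T'.comp z ∧ T'.vertex z = T.vertex x then M z x else 0) =
        ∑ w, if T.comp w = T.comp x ∧ T.vertex w = T'.vertex y then M y w else 0)
    ⟨fun ⟨h₁, h₂⟩ => ⟨h₁, h₂⟩, fun ⟨h₁, h₂⟩ => ⟨h₁, h₂⟩⟩

end Decidable

section Algebras

variable (K : Type) [Field K] {P : Type} [Fintype P] [DecidableEq P]

/-- The algebra of matrices supported on a reflexive and transitive relation. -/
def supportedMatrices (r : P → P → Prop) (hr : ∀ i, r i i)
    (ht : ∀ i j k, r i j → r j k → r i k) : Subalgebra K (Matrix P P K) where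
  carrier := {M | ∀ i j, ¬ r i j → M i j = 0}
  mul_mem' := by
    intro M N hM hN i k hik
    rw [Matrix.mul_apply]
    refine Finset.sum_eq_zero fun j _ => ?_
    by_cases hij : r i j
    · rw [hN j k fun hjk => hik (ht i j k hij hjk), mul_zero]
    · rw [hM i j hij, zero_mul]
  add_mem' := by
    intro M N hM hN i j hij
    rw [Matrix.add_apply, hM i j hij, hN i j hij, add_zero]
  algebraMap_mem' := by
    intro k i j hij
    rw [Matrix.algebraMap_matrix_apply, if_neg]
    rintro rfl
    exact hij (hr i)

variable (r : P → P → Prop) (hr : ∀ i, r i i) (ht : ∀ i j k, r i j → r j k → r i k)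

/-- The tautological model of the algebra of matrices supported on `r`. -/
def supportedModel : IncidenceModel K (supportedMatrices K r hr ht) r where
  toMat := (supportedMatrices K r hr ht).val
  injective := Subtype.val_injective
  apply_eq_zero a := a.2
  surjective M hM := ⟨⟨M, hM⟩, rfl⟩

/-- The model of the opposite of an algebra of matrices, given by transposition. -/
def supportedOpModel : IncidenceModel K (supportedMatrices K r hr ht)ᵐᵒᵖ fun i j => r j i where
  toMat := (Matrix.transposeAlgEquiv P K K).symm.toAlgHom.comp (supportedMatrices K r hr ht).val.op
  injective := (Matrix.transposeAlgEquiv P K K).symm.injective.comp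
    (MulOpposite.op_injective.comp (Subtype.val_injective.comp MulOpposite.unop_injective))
  apply_eq_zero a i j h := a.unop.2 j i h
  surjective M hM := ⟨MulOpposite.op ⟨M.transpose, fun i j h => hM j i h⟩, rfl⟩

end Algebras

section Example

/-- The relation describing the path algebra `S` of the quiver `4 → 5 → 6`. -/
def lowerRel (i j : Fin 3) : Prop := j ≤ i

/-- The relation describing the right modules over the path algebra `R` of the quiver
`2 → 1 ← 3`. -/
def vRel (i j : Fin 3) : Prop := i = j ∨ j = 1

instance : DecidableRel lowerRel := fun i j => inferInstanceAs (Decidable (j ≤ i))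

instance : DecidableRel vRel := fun i j => inferInstanceAs (Decidable (i = j ∨ j = 1))

/-- The zero-one matrix with the given support. -/
def unitSum {m n : ℕ} (l : List (ℕ × ℕ)) : Matrix (Fin m) (Fin n) (ZMod 2) :=
  Matrix.of fun i j => if (i.val, j.val) ∈ l then 1 else 0

/-- The left `S`-module `C`. -/
def leftShape : Shape (Fin 3) 6 := ⟨![0, 1, 2, 1, 2, 1], ![0, 0, 0, 1, 1, 2]⟩

/-- The right `R`-module `C`. -/
def rightShape : Shape (Fin 3) 6 := ⟨![0, 0, 0, 1, 1, 2], ![0, 1, 2, 1, 2, 1]⟩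

/-- The injective envelope of the left `S`-module `C`. -/
def leftEnvelope : Shape (Fin 3) 8 := ⟨![0, 1, 2, 1, 2, 1, 0, 0], ![0, 0, 0, 1, 1, 2, 1, 2]⟩

/-- The socles of the summands of `leftEnvelope`. -/
def leftSocle : Fin 8 → Fin 8 := ![2, 2, 2, 4, 4, 5, 4, 5]

/-- The right `R`-module structure of the bimodule `D`. -/
def leftEnvelopeRight : Shape (Fin 3) 8 := ⟨![0, 0, 0, 1, 1, 2, 1, 2], ![0, 1, 2, 1, 2, 1, 0, 0]⟩

/-- The injective envelope of the right `R`-module `C`. -/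
def rightEnvelope : Shape (Fin 3) 8 := ⟨![0, 0, 0, 1, 1, 1, 1, 2], ![0, 1, 2, 0, 1, 2, 3, 3]⟩

/-- The socles of the summands of `rightEnvelope`. -/
def rightSocle : Fin 8 → Fin 8 := ![0, 1, 2, 0, 1, 2, 7, 7]

/-- The left `S`-module structure of the decomposable bimodule of the example. -/
def rightEnvelopeLeft : Shape (Fin 3) 8 := ⟨![0, 1, 2, 0, 1, 2, 1, 1], ![0, 0, 0, 1, 1, 1, 2, 3]⟩

/-- The embedding of `C` into `D`. -/
def leftEmbedding : Matrix (Fin 8) (Fin 6) (ZMod 2) :=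
  unitSum [(0, 0), (1, 1), (2, 2), (3, 3), (4, 4), (5, 5)]

/-- The embedding of `C` into the decomposable bimodule of the example. -/
def rightEmbedding : Matrix (Fin 8) (Fin 6) (ZMod 2) :=
  unitSum [(0, 0), (1, 1), (2, 2), (4, 3), (6, 3), (5, 4), (7, 5)]

lemma Shape.inPower_of_embedding {r : Fin 3 → Fin 3 → Prop} {n m k : ℕ} {T : Shape (Fin 3) n}
    {N : Shape (Fin 3) m} (e : Fin m → Fin k × Fin n)
    (hS : ∀ t, N.Intertwines r T (Matrix.of fun y x => if e x = (t, y) then (1 : ZMod 2) else 0))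
    (hR : ∀ t, T.Intertwines r N (Matrix.of fun x y => if e x = (t, y) then (1 : ZMod 2) else 0))
    (he : Function.Injective e) : T.InPower (ZMod 2) r N := by
  refine ⟨k, _, _, hS, hR, ?_⟩
  ext x z
  rw [Matrix.sum_apply]
  simp_rw [Matrix.mul_apply, Matrix.of_apply]
  rw [← Fintype.sum_prod_type', Finset.sum_eq_single (e x)]
  · simp [Matrix.one_apply, he.eq_iff, eq_comm]
  · intro p _ hp
    simp [hp.symm]
  · simp

/-- The left `S`-module `C` is a classical cotilting module. -/
def leftCertificate : leftShape.CotiltingCertificate (ZMod 2) lowerRel where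
  E := leftEnvelope
  F := ⟨![0, 0], ![0, 1]⟩
  Q := ⟨![0, 1, 2, 0, 1, 0], ![0, 0, 0, 1, 1, 2]⟩
  C' := ⟨![1, 2, 1, 2], ![0, 0, 1, 1]⟩
  C'' := ⟨![0, 1, 2, 0, 1, 2, 0, 1, 2, 1], ![0, 0, 0, 1, 1, 1, 2, 2, 2, 3]⟩
  convex_E := by decide
  convex_F := by decide
  convex_Q := by decide
  convex_C' := by decide
  convex_C'' := by decide
  sE := leftSocle
  sF := ![0, 1]
  sQ := ![2, 2, 2, 4, 4, 5]
  cofree_E := by decide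
  cofree_F := by decide
  cofree_Q := by decide
  J := leftEmbedding
  G := unitSum [(0, 6), (1, 7)]
  intertwines_J := by decide +kernel
  intertwines_G := by decide +kernel
  exact_JG := ⟨unitSum [(0, 0), (1, 1), (2, 2), (3, 3), (4, 4), (5, 5)],
    unitSum [(6, 0), (7, 1)], by decide +kernel, by decide +kernel,
    by decide +kernel, by decide +kernel⟩
  top := 0
  vertex_F := by decide
  σ := ![6, 7]
  vertex_σ := by decide
  section_G := by decide +kernel
  reach := by decide
  cogenerator_Q := by decide
  U := unitSum [(4, 0), (9, 0), (5, 1), (7, 2), (8, 3)]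
  V := unitSum [(0, 0), (1, 1), (2, 2), (3, 3), (4, 4), (4, 9), (5, 6)]
  intertwines_U := by decide +kernel
  intertwines_V := by decide +kernel
  exact_UV := ⟨unitSum [(0, 9), (1, 5), (2, 7), (3, 8)],
    unitSum [(0, 0), (1, 1), (2, 2), (3, 3), (4, 4), (6, 5)],
    by decide +kernel, by decide +kernel, by decide +kernel, by decide +kernel⟩
  inPower_C' := Shape.inPower_of_embedding (k := 2) ![(0, 3), (0, 4), (1, 3), (1, 4)]
    (by decide +kernel) (by decide +kernel) (by decide)
  inPower_C'' := Shape.inPower_of_embedding (k := 4)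
    ![(0, 0), (0, 1), (0, 2), (1, 0), (1, 1), (1, 2), (2, 0), (2, 1), (2, 2), (3, 5)]
    (by decide +kernel) (by decide +kernel) (by decide)

/-- The right `R`-module `C` is a classical cotilting module. -/
def rightCertificate : rightShape.CotiltingCertificate (ZMod 2) vRel where
  E := rightEnvelope
  F := ⟨![1, 1], ![0, 1]⟩
  Q := ⟨![0, 1, 1, 2, 1], ![0, 0, 1, 1, 2]⟩
  C' := ⟨![0, 0], ![0, 1]⟩
  C'' := ⟨![0, 1, 0, 1, 0, 1, 2], ![0, 0, 1, 1, 2, 2, 2]⟩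
  convex_E := by decide
  convex_F := by decide
  convex_Q := by decide
  convex_C' := by decide
  convex_C'' := by decide
  sE := rightSocle
  sF := ![0, 1]
  sQ := ![0, 0, 3, 3, 4]
  cofree_E := by decide
  cofree_F := by decide
  cofree_Q := by decide
  J := rightEmbedding
  G := unitSum [(0, 3), (1, 4), (1, 6)]
  intertwines_J := by decide +kernel
  intertwines_G := by decide +kernel
  exact_JG := ⟨unitSum [(0, 0), (1, 1), (2, 2), (3, 6), (4, 5), (5, 7)],
    unitSum [(3, 0), (4, 1)], by decide +kernel, by decide +kernel,
    by decide +kernel, by decide +kernel⟩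
  top := 1
  vertex_F := by decide
  σ := ![3, 4]
  vertex_σ := by decide
  section_G := by decide +kernel
  reach := by decide
  cogenerator_Q := by decide
  U := unitSum [(2, 0), (4, 1)]
  V := unitSum [(0, 0), (1, 1), (4, 3), (2, 5), (3, 6)]
  intertwines_U := by decide +kernel
  intertwines_V := by decide +kernel
  exact_UV := ⟨unitSum [(0, 2), (1, 4)],
    unitSum [(0, 0), (1, 1), (5, 2), (6, 3), (3, 4)],
    by decide +kernel, by decide +kernel, by decide +kernel, by decide +kernel⟩
  inPower_C' := Shape.inPower_of_embedding (k := 2) ![(0, 0), (1, 0)]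
    (by decide +kernel) (by decide +kernel) (by decide)
  inPower_C'' := Shape.inPower_of_embedding (k := 3)
    ![(0, 2), (0, 4), (1, 2), (1, 4), (2, 1), (2, 3), (2, 5)]
    (by decide +kernel) (by decide +kernel) (by decide)

lemma leftShape_balanced (M : Matrix (Fin 6) (Fin 6) (ZMod 2))
    (hM : rightShape.Intertwines vRel rightShape M) :
    ∃ N : Matrix (Fin 3) (Fin 3) (ZMod 2), (∀ i j, ¬ lowerRel i j → N i j = 0) ∧
      leftShape.mat N = M := by
  have nat := hM.natural
  simp only [rightShape, Fin.sum_univ_succ] at nat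
  have h01 : 0 = M 0 1 := by simpa using nat 0 3 (by decide)
  have h02 : 0 = M 0 2 := by simpa using nat 0 4 (by decide)
  have h34 : M 3 4 = 0 := by simpa using nat 5 4 (by decide)
  have h12 : M 3 4 = M 1 2 := by simpa using nat 1 4 (by decide)
  have h33 : M 3 3 = M 1 1 := by simpa using nat 1 3 (by decide)
  have h55 : M 3 3 = M 5 5 := by simpa using nat 5 3 (by decide)
  have h44 : M 4 4 = M 2 2 := by simpa using nat 2 4 (by decide)
  have h43 : M 4 3 = M 2 1 := by simpa using nat 2 3 (by decide)
  refine ⟨!![M 0 0, 0, 0; M 1 0, M 1 1, 0; M 2 0, M 2 1, M 2 2], ?_, ?_⟩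
  · intro i j hij
    fin_cases i <;> fin_cases j <;> first | rfl | exact absurd (by decide) hij
  · ext x y
    by_cases hxy : rightShape.vertex x = rightShape.vertex y
    · fin_cases x <;> fin_cases y <;> first | exact absurd hxy (by decide) | skip
      all_goals simp [Shape.mat_apply, leftShape]
      all_goals grind
    · rw [hM.homogeneous x y hxy]
      fin_cases x <;> fin_cases y <;> first | rfl | exact absurd (by decide) hxy

lemma rightShape_balanced (M : Matrix (Fin 6) (Fin 6) (ZMod 2))
    (hM : leftShape.Intertwines lowerRel leftShape M) :
    ∃ N : Matrix (Fin 3) (Fin 3) (ZMod 2), (∀ i j, ¬ vRel i j → N i j = 0) ∧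
      rightShape.mat N = M := by
  have nat := hM.natural
  simp only [leftShape, Fin.sum_univ_succ] at nat
  have h11 : M 0 0 = M 1 1 := by simpa using nat 1 0 (by decide)
  have h22 : M 0 0 = M 2 2 := by simpa using nat 2 0 (by decide)
  have h33 : M 3 3 = M 4 4 := by simpa using nat 4 3 (by decide)
  have h13 : M 1 3 = M 2 4 := by simpa using nat 2 3 (by decide)
  have h51 : 0 = M 5 1 := by simpa using nat 5 0 (by decide)
  have h31 : 0 = M 3 1 := by simpa using nat 3 0 (by decide)
  have h42 : 0 = M 4 2 := by simpa using nat 4 0 (by decide)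
  have h15 : M 1 5 = 0 := by simpa using nat 2 5 (by decide)
  have h35 : M 3 5 = 0 := by simpa using nat 4 5 (by decide)
  refine ⟨!![M 0 0, M 1 3, 0; 0, M 3 3, 0; 0, M 5 3, M 5 5], ?_, ?_⟩
  · intro i j hij
    fin_cases i <;> fin_cases j <;> first | rfl | exact absurd (by decide) hij
  · ext x y
    by_cases hxy : leftShape.vertex x = leftShape.vertex y
    · fin_cases x <;> fin_cases y <;> first | exact absurd hxy (by decide) | skip
      all_goals simp [Shape.mat_apply, rightShape]
      all_goals grind
    · rw [hM.homogeneous x y hxy]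
      fin_cases x <;> fin_cases y <;> first | rfl | exact absurd (by decide) hxy

/-- The path algebra `S`. -/
abbrev lowerAlgebra : Subalgebra (ZMod 2) (Matrix (Fin 3) (Fin 3) (ZMod 2)) :=
  supportedMatrices (ZMod 2) lowerRel (by decide) (by decide)

/-- The path algebra `R`. -/
abbrev vAlgebra : Subalgebra (ZMod 2) (Matrix (Fin 3) (Fin 3) (ZMod 2)) :=
  supportedMatrices (ZMod 2) (fun i j => vRel j i) (by decide) (by decide)

/-- Left `S`-modules as representations. -/
abbrev leftModel : IncidenceModel (ZMod 2) lowerAlgebra lowerRel := supportedModel _ _ _ _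

/-- Right `R`-modules as representations. -/
abbrev rightModel : IncidenceModel (ZMod 2) vAlgebraᵐᵒᵖ vRel := supportedOpModel _ _ _ _

lemma leftShape_commutes : leftShape.Commutes lowerRel vRel rightShape :=
  ⟨by decide, by decide, by decide⟩

lemma leftEnvelope_commutes : leftEnvelope.Commutes lowerRel vRel leftEnvelopeRight :=
  ⟨by decide, by decide, by decide⟩

lemma rightEnvelope_commutes : rightEnvelopeLeft.Commutes lowerRel vRel rightEnvelope :=
  ⟨by decide, by decide, by decide⟩

section Cotilting

variable [Module lowerAlgebra (Fin 6 → ZMod 2)] [Module vAlgebraᵐᵒᵖ (Fin 6 → ZMod 2)]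
  [SMulCommClass lowerAlgebra vAlgebraᵐᵒᵖ (Fin 6 → ZMod 2)] (hS : leftModel.ActsBy leftShape)
  (hR : rightModel.ActsBy rightShape)

include hS hR

lemma isCotiltingBimodule :
    IsCotiltingBimodule (ZMod 2) lowerAlgebra vAlgebra (Fin 6 → ZMod 2) := by
  have := SMulCommClass.symm lowerAlgebra vAlgebraᵐᵒᵖ (Fin 6 → ZMod 2)
  exact ⟨hS.bijective_toModuleEnd hR (by decide) (by decide) (by decide) leftShape_balanced,
    hR.bijective_toModuleEnd hS (by decide) (by decide) (by decide) rightShape_balanced,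
    hS.isClassicalCotilting (by decide) (by decide) leftCertificate,
    hR.isClassicalCotilting (by decide) (by decide) rightCertificate⟩

omit [SMulCommClass lowerAlgebra vAlgebraᵐᵒᵖ (Fin 6 → ZMod 2)] in
lemma bimodIndecomposable_cotilting :
    BimodIndecomposable lowerAlgebra vAlgebraᵐᵒᵖ (Fin 6 → ZMod 2) :=
  hS.bimodIndecomposable hR (by decide) (by decide) (by decide) (by decide) (by decide)
    (parent := ![1, 1, 1, 1, 3, 3]) (by unfold Shape.Adj; decide) (root := 1) (k := 2) (by decide)

end Cotilting

section Envelopes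

variable [Module lowerAlgebra (Fin 6 → ZMod 2)] [Module vAlgebraᵐᵒᵖ (Fin 6 → ZMod 2)]
  (hS : leftModel.ActsBy leftShape) (hR : rightModel.ActsBy rightShape)

include hS hR

lemma exists_indecomposable_leftEnvelope :
    ∃ (E : Type) (_ : AddCommGroup E) (_ : Module lowerAlgebra E) (_ : Module vAlgebraᵐᵒᵖ E)
      (_ : Module (ZMod 2) E) (j : (Fin 6 → ZMod 2) →ₗ[lowerAlgebra] E),
      IsScalarTower (ZMod 2) lowerAlgebra E ∧ SMulCommClass lowerAlgebra vAlgebraᵐᵒᵖ E ∧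
      Module.finrank (ZMod 2) E = 8 ∧ IsInjEnvelope lowerAlgebra (Fin 6 → ZMod 2) E j ∧
      (∀ (r : vAlgebraᵐᵒᵖ) (c : Fin 6 → ZMod 2), j (r • c) = r • j c) ∧
      BimodIndecomposable lowerAlgebra vAlgebraᵐᵒᵖ E := by
  let _ := leftModel.thinModule leftEnvelope (by decide)
  let _ := rightModel.thinModule leftEnvelopeRight (by decide)
  have hSE : leftModel.ActsBy leftEnvelope := leftModel.actsBy_thinModule _ _
  have hRE : rightModel.ActsBy leftEnvelopeRight := rightModel.actsBy_thinModule _ _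
  have hSJ : leftShape.Intertwines lowerRel leftEnvelope leftEmbedding := by decide +kernel
  have hRJ : rightShape.Intertwines vRel leftEnvelopeRight leftEmbedding := by decide +kernel
  refine ⟨Fin 8 → ZMod 2, inferInstance, inferInstance, inferInstance, inferInstance,
    hS.hom hSE hSJ, hSE.isScalarTower, hSE.smulCommClass hRE leftEnvelope_commutes,
    Module.finrank_fintype_fun_eq_card _, ?_, (hR.hom hRE hRJ).map_smul, ?_⟩
  · exact hS.isInjEnvelope_hom hSE (by decide) (s := leftSocle) (by decide) hSJ
      (J' := unitSum [(0, 0), (1, 1), (2, 2), (3, 3), (4, 4), (5, 5)])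
      (by decide +kernel) (by decide +kernel)
  · exact hSE.bimodIndecomposable hRE (by decide) (by decide) (by decide) (by decide) (by decide)
      (parent := ![1, 1, 1, 1, 3, 3, 3, 5]) (by unfold Shape.Adj; decide) (root := 1) (k := 3)
      (by decide)

lemma exists_decomposable_rightEnvelope :
    ∃ (E : Type) (_ : AddCommGroup E) (_ : Module lowerAlgebra E) (_ : Module vAlgebraᵐᵒᵖ E)
      (_ : Module (ZMod 2) E) (j : (Fin 6 → ZMod 2) →ₗ[vAlgebraᵐᵒᵖ] E),
      IsScalarTower (ZMod 2) vAlgebraᵐᵒᵖ E ∧ SMulCommClass lowerAlgebra vAlgebraᵐᵒᵖ E ∧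
      Module.finrank (ZMod 2) E = 8 ∧ IsInjEnvelope vAlgebraᵐᵒᵖ (Fin 6 → ZMod 2) E j ∧
      (∀ (s : lowerAlgebra) (c : Fin 6 → ZMod 2), j (s • c) = s • j c) ∧
      BimodDecomposable vAlgebraᵐᵒᵖ lowerAlgebra E := by
  let _ := leftModel.thinModule rightEnvelopeLeft (by decide)
  let _ := rightModel.thinModule rightEnvelope (by decide)
  have hSE : leftModel.ActsBy rightEnvelopeLeft := leftModel.actsBy_thinModule _ _
  have hRE : rightModel.ActsBy rightEnvelope := rightModel.actsBy_thinModule _ _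
  have hSJ : leftShape.Intertwines lowerRel rightEnvelopeLeft rightEmbedding := by decide +kernel
  have hRJ : rightShape.Intertwines vRel rightEnvelope rightEmbedding := by decide +kernel
  refine ⟨Fin 8 → ZMod 2, inferInstance, inferInstance, inferInstance, inferInstance,
    hR.hom hRE hRJ, hRE.isScalarTower, hSE.smulCommClass hRE rightEnvelope_commutes,
    Module.finrank_fintype_fun_eq_card _, ?_, (hS.hom hSE hSJ).map_smul, ?_⟩
  · exact hR.isInjEnvelope_hom hRE (by decide) (s := rightSocle) (by decide) hRJ
      (J' := unitSum [(0, 0), (1, 1), (2, 2), (3, 6), (4, 5), (5, 7)])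
      (by decide +kernel) (by decide +kernel)
  · exact hRE.bimodDecomposable hSE (M := unitSum [(6, 6), (7, 7)]) (by decide +kernel)
      (by decide +kernel) (by decide +kernel) (by decide +kernel) (by decide +kernel)

end Envelopes

end Example

/-- There exists a `6`-dimensional indecomposable cotilting bimodule `C`
(over finite-dimensional algebras `S`, `R` over a field `K`) of codimension `2` in the
injective envelopes of both of its underlying one-sided modules, such that the left injective
envelope supports an indecomposable bimodule `D ⊇ C`, while the right injective envelope
supports a bimodule `D' ⊇ C` which decomposes as a direct sum of two nonzero sub-bimodules.
In particular, being an indecomposable bimodule is neither inherited by such extensions nor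
left-right symmetric. -/
theorem toy_cotilting_bimodule_exists : Nonempty ToyCotiltingExample := by
  let _ := leftModel.thinModule leftShape (by decide)
  let _ := rightModel.thinModule rightShape (by decide)
  have hS : leftModel.ActsBy leftShape := leftModel.actsBy_thinModule _ _
  have hR : rightModel.ActsBy rightShape := rightModel.actsBy_thinModule _ _
  have := hS.smulCommClass hR leftShape_commutes
  obtain ⟨E, _, _, _, _, j, _, _, dimE, envE, hj, indecD⟩ :=
    exists_indecomposable_leftEnvelope hS hR
  obtain ⟨E', _, _, _, _, j', _, _, dimE', envE', hj', decD'⟩ :=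
    exists_decomposable_rightEnvelope hS hR
  have dimC : Module.finrank (ZMod 2) (Fin 6 → ZMod 2) = 6 := Module.finrank_fintype_fun_eq_card _
  exact ⟨{
    K := ZMod 2
    S := lowerAlgebra
    finS := inferInstance
    R := vAlgebra
    finR := inferInstance
    C := Fin 6 → ZMod 2
    towSC := hS.isScalarTower
    towRC := hR.isScalarTower
    cotilting := isCotiltingBimodule hS hR
    dimC := dimC
    indecC := bimodIndecomposable_cotilting hS hR
    E := E
    j := j
    envE := envE
    codimE := by rw [dimE, dimC]
    j_right_linear := hj
    indecD := indecD
    E' := E'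
    j' := j'
    envE' := envE'
    codimE' := by rw [dimE', dimC]
    j'_left_linear := hj'
    decD' := decD' }⟩
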